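/- Let R be a ring and n ≥ 2 an integer. Then R is strongly n-nil-clean if and only if for every a in R the element a^{n-1} is strongly nil-clean, i.e., a^{n-1} = e + q for some idempotent e (e^2 = e) and nilpotent q with e*q = q*e. -/

import Mathlib

lemma aux_dvd {T : Type*} [CommRing T] (a : T) (m t : ℕ) :
    a ^ (m + 1) - a ∣ a ^ (m * t + 1) - a := by
  have h := sub_dvd_pow_sub_pow (a ^ m) 1 t
  rw [one_pow, ← pow_mul] at h
  have h2 := mul_dvd_mul_right h a
  rwa [sub_mul, sub_mul, one_mul, ← pow_succ, ← pow_succ] at h2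

lemma aux_nil_dvd {T : Type*} [CommRing T] {x y : T} (h : x ∣ y) (hx : IsNilpotent x) :
    IsNilpotent y := by
  obtain ⟨c, rfl⟩ := h
  exact (Commute.all x c).isNilpotent_mul_right hx

lemma aux_freeze {T : Type*} [CommRing T] {p : ℕ} (hp : p.Prime) (hpn : IsNilpotent (p : T))
    {x y : T} (h : IsNilpotent (x - y)) : ∃ K : ℕ, ∀ L, K ≤ L → x ^ p ^ L = y ^ p ^ L := by
  obtain ⟨j, hj⟩ := h
  obtain ⟨k, hk⟩ := hpn
  refine ⟨j + k, fun L hL => ?_⟩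
  obtain ⟨r, hr⟩ := exists_add_pow_prime_pow_eq hp (x - y) y j
  have h0 : (x - y) ^ p ^ j = 0 := pow_eq_zero_of_le (Nat.lt_pow_self hp.one_lt).le hj
  rw [sub_add_cancel, h0, zero_add] at hr
  have hd : (p : T) ∣ x ^ p ^ j - y ^ p ^ j := ⟨(x - y) * y * r, by rw [hr]; ring⟩
  have h1 := dvd_sub_pow_of_dvd_sub hd k
  rw [pow_succ, hk, zero_mul, zero_dvd_iff, ← pow_mul, ← pow_mul, ← pow_add, sub_eq_zero] at h1
  obtain ⟨s, rfl⟩ := Nat.exists_eq_add_of_le hL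
  rw [pow_add p (j + k) s, pow_mul, pow_mul, h1]

lemma aux_prime {T : Type*} [CommRing T] {p : ℕ} (hp : p.Prime) (hpn : IsNilpotent (p : T))
    {a : T} {m : ℕ} (hm : m ≠ 0) (h : IsNilpotent (a ^ (m + 1) - a)) :
    ∃ f : T, f ^ (m + 1) - f = 0 ∧ IsNilpotent (a - f) := by
  obtain ⟨k, m', hm', rfl⟩ := Nat.exists_eq_pow_mul_and_not_dvd hm p hp.ne_one
  have h1 : IsNilpotent (a ^ (m' + 1) - a) := by
    obtain ⟨r, hr⟩ := exists_add_pow_prime_pow_eq hp (a ^ m' - 1) 1 k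
    rw [sub_add_cancel, one_pow, ← pow_mul] at hr
    have h2 : a * (a ^ m' - 1) ^ p ^ k =
        (a ^ (p ^ k * m' + 1) - a) - (p : T) * (a * ((a ^ m' - 1) * 1 * r)) := by
      rw [pow_succ, mul_comm (p ^ k) m', hr]; ring
    have h3 : IsNilpotent (a * (a ^ m' - 1) ^ p ^ k) := by
      rw [h2]
      exact (Commute.all _ _).isNilpotent_sub h ((Commute.all _ _).isNilpotent_mul_right hpn)
    have hpk : p ^ k ≠ 0 := pow_ne_zero _ hp.ne_zero
    have h4 : IsNilpotent ((a ^ (m' + 1) - a) ^ p ^ k) := by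
      refine aux_nil_dvd ?_ h3
      have : a ^ (m' + 1) - a = a * (a ^ m' - 1) := by ring
      rw [this, mul_pow]
      exact mul_dvd_mul_right (dvd_pow_self a hpk) _
    exact h4.of_pow
  obtain ⟨K, hK⟩ := aux_freeze hp hpn h1
  have hm0 : 0 < m' := Nat.pos_of_ne_zero (by rintro rfl; simp at hm')
  have hphi : 0 < m'.totient := Nat.totient_pos.2 hm0
  have hcop : Nat.Coprime p m' := (Nat.Prime.coprime_iff_not_dvd hp).2 hm'
  have hmod : 1 ≡ p ^ (m'.totient * K) [MOD m'] := by
    have := (Nat.ModEq.pow_totient hcop).pow K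
    rw [one_pow, ← pow_mul] at this
    exact this.symm
  have h1le : 1 ≤ p ^ (m'.totient * K) := Nat.one_le_pow _ _ hp.pos
  obtain ⟨t, ht⟩ := (Nat.modEq_iff_dvd' h1le).1 hmod
  have ht' : p ^ (m'.totient * K) = m' * t + 1 := by omega
  have hf := hK (m'.totient * K) (Nat.le_mul_of_pos_left K hphi)
  refine ⟨a ^ p ^ (m'.totient * K), ?_, ?_⟩
  · have h5 := aux_dvd (a ^ p ^ (m'.totient * K)) m' (p ^ k)
    rw [← pow_mul, mul_comm _ (m' + 1), pow_mul, hf, sub_self, zero_dvd_iff, mul_comm m'] at h5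
    exact h5
  · rw [ht', ← neg_sub]
    exact (aux_nil_dvd (aux_dvd a m' t) h1).neg

lemma aux_N {S : Type*} [CommRing S] {a : S} {m : ℕ} (hm : m ≠ 0)
    (h : IsNilpotent (a ^ (m + 1) - a)) (N : ℕ) : N ≠ 0 →
    ∃ f : S, (N : S) ∣ f ^ (m + 1) - f ∧ ∃ k : ℕ, (N : S) ∣ (a - f) ^ k := by
  induction N using Nat.recOnPosPrimePosCoprime with
  | zero => intro h; exact absurd rfl h
  | one => intro _; exact ⟨0, by simp, 0, by simp⟩
  | prime_pow p j hp hj =>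
    intro _
    let I : Ideal S := Ideal.span {((p ^ j : ℕ) : S)}
    have hpn : IsNilpotent (p : S ⧸ I) := by
      refine ⟨j, ?_⟩
      have : Ideal.Quotient.mk I ((p ^ j : ℕ) : S) = 0 :=
        Ideal.Quotient.eq_zero_iff_mem.2 (Ideal.mem_span_singleton_self _)
      simpa using this
    have h' : IsNilpotent ((Ideal.Quotient.mk I a) ^ (m + 1) - Ideal.Quotient.mk I a) := by
      have := h.map (Ideal.Quotient.mk I)
      simpa using this
    obtain ⟨f, hf, k, hk⟩ := aux_prime hp hpn hm h'
    obtain ⟨f, rfl⟩ := Ideal.Quotient.mk_surjective f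
    rw [← map_pow, ← map_sub, Ideal.Quotient.eq_zero_iff_mem, Ideal.mem_span_singleton] at hf
    rw [← map_sub, ← map_pow, Ideal.Quotient.eq_zero_iff_mem, Ideal.mem_span_singleton] at hk
    exact ⟨f, hf, k, hk⟩
  | coprime u v hu hv huv ihu ihv =>
    intro _
    obtain ⟨f1, h1, k1, hk1⟩ := ihu (by omega)
    obtain ⟨f2, h2, k2, hk2⟩ := ihv (by omega)
    have hc : IsCoprime (u : S) (v : S) := huv.cast
    obtain ⟨x, y, hxy⟩ := hc
    have key : ∀ (w f g : S) (k : ℕ), w ∣ f - g → w ∣ g ^ (m + 1) - g → w ∣ (a - g) ^ k →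
        w ∣ f ^ (m + 1) - f ∧ w ∣ (a - f) ^ k := by
      intro w f g k hfg hg hk
      have e1 : w ∣ f ^ (m + 1) - g ^ (m + 1) := hfg.trans (sub_dvd_pow_sub_pow _ _ _)
      have e2 : w ∣ (a - f) ^ k - (a - g) ^ k := by
        refine dvd_trans ?_ (sub_dvd_pow_sub_pow _ _ _)
        rw [sub_sub_sub_cancel_left, ← neg_sub]
        exact hfg.neg_right
      constructor
      · have := dvd_add (dvd_sub e1 hfg) hg
        convert this using 1; ring
      · have := dvd_add e2 hk
        rwa [sub_add_cancel] at this
    have hA := key u (f1 * (y * v) + f2 * (x * u)) f1 k1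
      ⟨x * (f2 - f1), by linear_combination f1 * hxy⟩ h1 hk1
    have hB := key v (f1 * (y * v) + f2 * (x * u)) f2 k2
      ⟨y * (f1 - f2), by linear_combination f2 * hxy⟩ h2 hk2
    refine ⟨f1 * (y * v) + f2 * (x * u), ?_, k1 + k2, ?_⟩
    · rw [Nat.cast_mul]
      exact IsCoprime.mul_dvd ⟨x, y, hxy⟩ hA.1 hB.1
    · rw [Nat.cast_mul, pow_add]
      exact mul_dvd_mul hA.2 hB.2

lemma aux_back {R : Type*} [Ring R] {m : ℕ} (hm : m ≠ 0)
    (h : ∀ a : R, IsNilpotent (a ^ (m + 1) - a)) (a : R) :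
    ∃ f q : R, a = f + q ∧ f ^ (m + 1) = f ∧ IsNilpotent q ∧ f * q = q * f := by
  obtain ⟨k, hk⟩ := h 2
  have h2 : 2 < 2 ^ (m + 1) := by
    have : 1 < 2 ^ m := Nat.one_lt_two_pow hm
    rw [pow_succ]; omega
  have hN : ((((2 ^ (m + 1) - 2) ^ k : ℕ)) : R) = 0 := by
    rw [Nat.cast_pow, Nat.cast_sub h2.le]
    simpa using hk
  have hN0 : (2 ^ (m + 1) - 2) ^ k ≠ 0 := pow_ne_zero _ (by omega)
  generalize (2 ^ (m + 1) - 2) ^ k = N at hN hN0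
  let C := Subring.centralizer ({a} : Set R)
  let a1 : C := ⟨a, by simp [C, Subring.mem_centralizer_iff]⟩
  let a2 : Subring.center C := ⟨a1, by
    rw [Subring.mem_center_iff]
    intro g
    ext
    exact ((Subring.mem_centralizer_iff.1 g.2) a rfl).symm⟩
  let φ : Subring.center C →+* R := C.subtype.comp (Subring.center C).subtype
  have hφ : Function.Injective φ := Subtype.val_injective.comp Subtype.val_injective
  have hφa : φ a2 = a := rfl
  have ha2 : IsNilpotent (a2 ^ (m + 1) - a2) := by
    rw [← IsNilpotent.map_iff hφ, map_sub, map_pow, hφa]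
    exact h a
  obtain ⟨f, hf, l, hl⟩ := aux_N hm ha2 N hN0
  have hNS : (N : Subring.center C) = 0 := hφ (by rw [map_natCast, hN, map_zero])
  rw [hNS, zero_dvd_iff] at hf hl
  refine ⟨φ f, φ (a2 - f), ?_, ?_, ?_, ?_⟩
  · rw [map_sub, hφa, add_sub_cancel]
  · rw [← map_pow, sub_eq_zero.1 hf]
  · exact IsNilpotent.map ⟨l, hl⟩ φ
  · rw [← map_mul, ← map_mul, mul_comm]

lemma aux_nil {R : Type*} [Ring R] {m : ℕ} (hm : m ≠ 0) {a e q : R} (h : a ^ m = e + q)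
    (he : e ^ 2 = e) (hq : IsNilpotent q) (hc : e * q = q * e) :
    IsNilpotent (a ^ (m + 1) - a) := by
  have h1 : a ^ m * (a ^ m - 1) = q * (2 * e + q - 1) := by
    rw [h]
    have : (e + q) * (e + q - 1) = e ^ 2 + e * q + q * e + q * q - e - q := by noncomm_ring
    rw [this, he, hc]; noncomm_ring
  have hqc : Commute q e := hc.symm
  have hc2 : Commute q (2 * e + q - 1) :=
    ((((Nat.cast_commute 2 q).symm.mul_right hqc).add_right (Commute.refl q)).sub_right
      (Commute.one_right q))
  have h2 : IsNilpotent (a ^ m * (a ^ m - 1)) := by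
    rw [h1]; exact hc2.isNilpotent_mul_right hq
  have hca : Commute a (a ^ m - 1) := (Commute.self_pow a m).sub_right (Commute.one_right a)
  have h3 : a ^ (m + 1) - a = a * (a ^ m - 1) := by rw [mul_sub, mul_one, pow_succ']
  have h4 : IsNilpotent ((a * (a ^ m - 1)) ^ m) := by
    obtain ⟨j, rfl⟩ := Nat.exists_eq_succ_of_ne_zero hm
    rw [hca.mul_pow, pow_succ' (a ^ j.succ - 1) j, ← mul_assoc]
    refine Commute.isNilpotent_mul_right ?_ h2
    refine Commute.pow_right ?_ j
    exact (hca.pow_left _).mul_left (Commute.refl _)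
  rw [h3]
  exact h4.of_pow

theorem stmt_6 (R : Type*) [Ring R] (n : ℕ) (hn : 2 ≤ n) :
    (∀ a : R, ∃ f q : R, a = f + q ∧ f ^ n = f ∧ IsNilpotent q ∧ f * q = q * f) ↔
      (∀ a : R, ∃ e q : R, a ^ (n - 1) = e + q ∧ e ^ 2 = e ∧ IsNilpotent q ∧ e * q = q * e) := by
  obtain ⟨m, rfl⟩ : ∃ m, n = m + 1 := ⟨n - 1, by omega⟩
  have hm : m ≠ 0 := by omega
  rw [Nat.add_sub_cancel]
  constructor
  · intro h a
    obtain ⟨f, q, rfl, hf, hq, hc⟩ := h a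
    have hfq : Commute f q := hc
    have hcc : Commute (f + q) f := (Commute.refl f).add_left hfq.symm
    have hs : Commute (f + q) q := hfq.add_left (Commute.refl q)
    refine ⟨f ^ m, (f + q) ^ m - f ^ m, by rw [add_sub_cancel], ?_, ?_, ?_⟩
    · obtain ⟨j, rfl⟩ := Nat.exists_eq_succ_of_ne_zero hm
      rw [← pow_mul, show j.succ * 2 = (j.succ + 1) + j by omega, pow_add, hf, ← pow_succ']
    · rw [← hcc.mul_geom_sum₂]
      refine Commute.isNilpotent_mul_right ?_ (by simpa using hq)
      rw [add_sub_cancel_left]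
      refine Commute.sum_right _ _ _ fun i _ => ?_
      exact (hs.symm.pow_right _).mul_right (hfq.symm.pow_right _)
    · exact (((hcc.pow_pow m m).symm).sub_right (Commute.refl _)).eq
  · intro h
    refine aux_back hm fun a => ?_
    obtain ⟨e, q, h1, h2, h3, h4⟩ := h a
    exact aux_nil hm h1 h2 h3 h4
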